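/- arXiv:1806.04337 — 3 statements merged into one kernel-verified Lean document; each statement's English description precedes it below -/
import Mathlib

section
/- Let X be a set and let B be a bornology on X. Then B is approximated by the set of all bornologies of the form B_U, where U ranges over uniformities on X, if and only if B is antitall. (Theorem 2, equivalence (ii)⇔(iii).) -/
def IsBornology {X : Type*} (B : Set (Set X)) : Prop :=
  (∀ A ∈ B, ∀ A' ⊆ A, A' ∈ B) ∧ (∀ A ∈ B, ∀ A' ∈ B, A ∪ A' ∈ B) ∧ ∀ x : X, {x} ∈ B

def Antitall {X : Type*} (B : Set (Set X)) : Prop :=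
  ∀ Y : Set X, Y ∉ B → ∃ Z ⊆ Y, Z.Infinite ∧ ∀ Z' ⊆ Z, Z'.Infinite → Z' ∉ B

def Tall {X : Type*} (B : Set (Set X)) : Prop :=
  ∀ Y : Set X, Y.Infinite → ∃ Z ⊆ Y, Z.Infinite ∧ Z ∈ B

/-- A set that is not totally bounded contains an infinite set none of whose infinite subsets
is totally bounded. -/
theorem exists_infinite_forall_not_totallyBounded {X : Type*} [UniformSpace X] {Y : Set X}
    (hY : ¬ TotallyBounded Y) :
    ∃ Z ⊆ Y, Z.Infinite ∧ ∀ Z' ⊆ Z, Z'.Infinite → ¬ TotallyBounded Z' := by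
  simp only [TotallyBounded, not_forall, not_exists, not_and] at hY
  obtain ⟨d, hd, hdY⟩ := hY
  have step : ∀ t : Set X, t.Finite → ∃ c, c ∈ Y ∧ ∀ y ∈ t, (c, y) ∉ d := by
    intro t ht
    obtain ⟨c, hc, hct⟩ := Set.not_subset.1 (hdY t ht)
    exact ⟨c, hc, by simpa using hct⟩
  obtain ⟨u, hu⟩ := Set.seq_of_forall_finite_exists step
  have sep : ∀ m n, m < n → (u n, u m) ∉ d := fun m n hmn =>
    (hu n).2 _ (Set.mem_image_of_mem _ hmn)
  have inj : Function.Injective u := by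
    intro m n h
    by_contra hne
    rcases lt_or_gt_of_ne hne with hlt | hlt
    · exact sep _ _ hlt (h ▸ refl_mem_uniformity hd)
    · exact sep _ _ hlt (h ▸ refl_mem_uniformity hd)
  refine ⟨Set.range u, ?_, Set.infinite_range_of_injective inj, ?_⟩
  · rintro _ ⟨n, rfl⟩
    exact (hu n).1
  intro Z' hZ' hinf htb
  obtain ⟨e, he, hsymm, hed⟩ := comp_symm_mem_uniformity_sets hd
  obtain ⟨t, ht, hsub⟩ := htb e he
  have hmap : ∀ x ∈ Z', ∃ y ∈ t, (x, y) ∈ e := fun x hx => by simpa using hsub hx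
  choose! g hgt hge using hmap
  obtain ⟨a, ha, b, hb, hab, hg⟩ := hinf.exists_ne_map_eq_of_mapsTo hgt ht
  have close : ∀ a ∈ Z', ∀ b ∈ Z', g a = g b → (a, b) ∈ d := fun a ha b hb h =>
    hed ⟨g a, hge a ha, hsymm.symm _ _ (h ▸ hge b hb)⟩
  obtain ⟨m, rfl⟩ := hZ' ha
  obtain ⟨n, rfl⟩ := hZ' hb
  rcases lt_trichotomy m n with h | rfl | h
  · exact sep _ _ h (close _ hb _ ha hg.symm)
  · exact hab rfl
  · exact sep _ _ h (close _ ha _ hb hg)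

/-- In the uniformity induced by a map to a discrete uniform space, the totally bounded sets are
those with finite image. -/
theorem totallyBounded_comap_bot_iff {X Y : Type*} (f : X → Y) (A : Set X) :
    @TotallyBounded X (UniformSpace.comap f ⊥) A ↔ (f '' A).Finite := by
  let _ : UniformSpace Y := ⊥
  let _ : UniformSpace X := UniformSpace.comap f ⊥
  have hf : IsUniformInducing f := ⟨rfl⟩
  rw [← totallyBounded_image_iff hf]
  refine ⟨fun h => ?_, Set.Finite.totallyBounded⟩
  obtain ⟨t, ht, hsub⟩ := h SetRel.id (Filter.mem_principal_self _)
  refine ht.subset fun y hy => ?_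
  simpa using hsub hy

theorem stmt_3 {X : Type*} (B : Set (Set X)) (hB : IsBornology B) :
    (∀ Y : Set X, Y ∉ B → ∃ U : UniformSpace X,
      B ⊆ {A : Set X | @TotallyBounded X U A} ∧ Y ∉ {A : Set X | @TotallyBounded X U A}) ↔
    Antitall B := by
  classical
  constructor
  · intro h Y hY
    obtain ⟨U, hBU, hYU⟩ := h Y hY
    obtain ⟨Z, hZY, hZ, hZ'⟩ := exists_infinite_forall_not_totallyBounded hYU
    exact ⟨Z, hZY, hZ, fun Z' hs hi hmem => hZ' Z' hs hi (hBU hmem)⟩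
  · intro h Y hY
    obtain ⟨Z, hZY, hZ, hZB⟩ := h Y hY
    let f : X → Option X := fun x => if x ∈ Z then some x else none
    refine ⟨UniformSpace.comap f ⊥, fun A hA => ?_, fun hYU => ?_⟩
    · refine (totallyBounded_comap_bot_iff f A).2 ?_
      have hfin : (A ∩ Z).Finite := by
        by_contra hinf
        exact hZB _ Set.inter_subset_right hinf (hB.1 A hA _ Set.inter_subset_left)
      refine ((hfin.image some).insert none).subset ?_
      rintro _ ⟨x, hx, rfl⟩
      by_cases hxZ : x ∈ Z <;> simp [f, hxZ, hx]
    · have hfin := (totallyBounded_comap_bot_iff f Y).1 hYU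
      refine hZ (Set.Finite.of_finite_image (hfin.subset (Set.image_mono hZY)) ?_)
      intro x hx y hy hxy
      simpa [f, hx, hy] using hxy
end

section
/- Let X be an infinite set. A bornology B on X is antitall if and only if the set B^ = {p ∈ X* : ∀ A ∈ B, A ∉ p} has a dense subset that is open in X*, where X* is the space of nonprincipal ultrafilters on X. (Proposition 1, second part.) -/
/-- The hat of a family B: the set of free ultrafilters containing no member of B,
viewed inside the space X* of free (nonprincipal) ultrafilters on X. -/
def hatSet {X : Type*} (B : Set (Set X)) :
    Set {p : Ultrafilter X // ∀ x : X, p ≠ pure x} :=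
  {p | ∀ A ∈ B, A ∉ p.1}

/-- The finite sets form a bornology. -/
theorem isBornology_setOf_finite (X : Type*) : IsBornology {A : Set X | A.Finite} :=
  ⟨fun _ hA _ h => hA.subset h, fun _ hA _ hA' => hA.union hA', Set.finite_singleton⟩

/-- A set outside a bornology on a nonempty set belongs to a free ultrafilter avoiding the
bornology. -/
theorem IsBornology.exists_mem_hatSet {X : Type*} [Nonempty X] {B : Set (Set X)}
    (hB : IsBornology B) {Y : Set X} (hY : Y ∉ B) : ∃ p ∈ hatSet B, Y ∈ p.1 := by
  obtain ⟨hsub, hunion, hsing⟩ := hB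
  have hempty : ∅ ∈ B := hsub _ (hsing (Classical.arbitrary X)) _ (Set.empty_subset _)
  let F : Filter X :=
    { sets := {S | Y \ S ∈ B}
      univ_sets := by simpa using hempty
      sets_of_superset := fun hS h => hsub _ hS _ (Set.sdiff_subset_sdiff_right h)
      inter_sets := fun {S T} hS hT => by
        simpa [Set.sdiff_inter] using hunion _ hS _ hT }
  have hF {S : Set X} : S ∈ F ↔ Y \ S ∈ B := Iff.rfl
  have : F.NeBot := ⟨fun h => hY <| by
    have : (∅ : Set X) ∈ F := h ▸ Filter.mem_bot
    simpa [hF] using this⟩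
  have havoid : ∀ A ∈ B, A ∉ Ultrafilter.of F := fun A hA =>
    Ultrafilter.compl_mem_iff_notMem.1 <| Ultrafilter.of_le F <|
      hF.2 (hsub A hA _ (by simp))
  refine ⟨⟨Ultrafilter.of F, fun x hx => havoid _ (hsing x) ?_⟩, havoid,
    Ultrafilter.of_le F (hF.2 (by simpa using hempty))⟩
  rw [hx]
  exact Ultrafilter.mem_pure.2 rfl

/-- Members of a free ultrafilter are infinite. -/
theorem Ultrafilter.infinite_of_mem_of_ne_pure {X : Type*} {p : Ultrafilter X}
    (hp : ∀ x, p ≠ pure x) {Z : Set X} (hZ : Z ∈ p) : Z.Infinite := fun hfin =>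
  let ⟨x, _, hx⟩ := Ultrafilter.eq_pure_of_finite_mem hfin hZ
  hp x hx

/-- The sets of free ultrafilters containing a given set form a basis of the space of free
ultrafilters. -/
theorem isTopologicalBasis_freeUltrafilter (X : Type*) :
    TopologicalSpace.IsTopologicalBasis (Set.range fun A : Set X =>
      {p : {p : Ultrafilter X // ∀ x : X, p ≠ pure x} | A ∈ p.1}) := by
  have h := (ultrafilterBasis_is_basis (α := X)).isInducing
    (f := (Subtype.val : {p : Ultrafilter X // ∀ x : X, p ≠ pure x} → Ultrafilter X))
    Topology.IsInducing.subtypeVal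
  rw [ultrafilterBasis.eq_def, ← Set.range_comp] at h
  exact h

theorem stmt_7 {X : Type*} [Infinite X] (B : Set (Set X)) (hB : IsBornology B) :
    Antitall B ↔
      ∃ D : Set {p : Ultrafilter X // ∀ x : X, p ≠ pure x},
        D ⊆ hatSet B ∧ IsOpen D ∧ hatSet B ⊆ closure D := by
  have hbasis := isTopologicalBasis_freeUltrafilter X
  constructor
  · intro hanti
    refine ⟨{p | ∃ Z ∈ p.1, ∀ Z' ⊆ Z, Z'.Infinite → Z' ∉ B}, ?_, ?_, ?_⟩
    · rintro p ⟨Z, hZp, hZ⟩ A hA hAp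
      exact hZ (Z ∩ A) Set.inter_subset_left
        (Ultrafilter.infinite_of_mem_of_ne_pure p.2 (Filter.inter_mem hZp hAp))
        (hB.1 A hA _ Set.inter_subset_right)
    · rw [hbasis.isOpen_iff]
      rintro p ⟨Z, hZp, hZ⟩
      exact ⟨_, ⟨Z, rfl⟩, hZp, fun q hq => ⟨Z, hq, hZ⟩⟩
    · intro p hp
      rw [hbasis.mem_closure_iff]
      rintro _ ⟨Y, rfl⟩ hYp
      obtain ⟨Z, hZY, hZinf, hZ⟩ := hanti Y fun hY => hp Y hY hYp
      obtain ⟨q, -, hZq⟩ := (isBornology_setOf_finite X).exists_mem_hatSet hZinf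
      exact ⟨q, Filter.mem_of_superset hZq hZY, Z, hZq, hZ⟩
  · rintro ⟨D, hDB, hDopen, hDdense⟩ Y hY
    obtain ⟨p, hp, hYp⟩ := hB.exists_mem_hatSet hY
    obtain ⟨q, hYq, hqD⟩ := hbasis.mem_closure_iff.1 (hDdense hp) _ ⟨Y, rfl⟩ hYp
    obtain ⟨_, ⟨Z, rfl⟩, hZq, hZD⟩ := hbasis.isOpen_iff.1 hDopen q hqD
    refine ⟨Y ∩ Z, Set.inter_subset_left,
      Ultrafilter.infinite_of_mem_of_ne_pure q.2 (Filter.inter_mem hYq hZq), ?_⟩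
    intro Z' hZ' hinf hZ'B
    obtain ⟨r, -, hZ'r⟩ := (isBornology_setOf_finite X).exists_mem_hatSet hinf
    exact hDB (hZD (Filter.mem_of_superset hZ'r fun x hx => (hZ' hx).2)) Z' hZ'B hZ'r
end

section
/- Let X be an infinite set and let B be a bornology on X. Then, computing closures and interiors inside the space X* of nonprincipal ultrafilters on X, one has (B^¬)^ = closure( X* \ closure( interior( B^ ) ) ), where B^ = {p ∈ X* : ∀ A ∈ B, A ∉ p} and (B^¬)^ = {p ∈ X* : ∀ A ∈ B^¬, A ∉ p}. (Topological identity for the operation ¬ stated in Section 4.) -/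
/-- For a family F of subsets of X, F^¬ is the family of all subsets of X
none of whose infinite subsets belongs to F. -/
def negOp {X : Type*} (F : Set (Set X)) : Set (Set X) :=
  {A : Set X | ∀ Z ⊆ A, Z.Infinite → Z ∉ F}

open Set

/-- A member of a free ultrafilter is infinite. -/
theorem Ultrafilter.infinite_of_mem_of_forall_ne_pure {X : Type*} {p : Ultrafilter X}
    (hp : ∀ x : X, p ≠ pure x) {A : Set X} (hA : A ∈ p) : A.Infinite := fun hfin => by
  obtain ⟨x, -, hx⟩ := Ultrafilter.eq_pure_of_finite_mem hfin hA
  exact hp x hx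

/-- Every infinite set belongs to a free ultrafilter. -/
theorem Set.Infinite.exists_free_ultrafilter_mem {X : Type*} {Z : Set X} (hZ : Z.Infinite) :
    ∃ p : {p : Ultrafilter X // ∀ x : X, p ≠ pure x}, Z ∈ p.1 := by
  have hne : (Filter.cofinite ⊓ Filter.principal Z).NeBot := hZ.cofinite_inf_principal_neBot
  have hle := Ultrafilter.of_le (Filter.cofinite ⊓ Filter.principal Z)
  refine ⟨⟨Ultrafilter.of _, fun x hx => ?_⟩,
    hle (Filter.mem_inf_of_right (Filter.mem_principal_self Z))⟩
  have hmem : ({x}ᶜ : Set X) ∈ Ultrafilter.of (Filter.cofinite ⊓ Filter.principal Z) :=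
    hle (Filter.mem_inf_of_left (finite_singleton x).compl_mem_cofinite)
  rw [hx, Ultrafilter.mem_pure] at hmem
  exact hmem rfl

theorem isClosed_hatSet {X : Type*} (B : Set (Set X)) : IsClosed (hatSet B) := by
  have : hatSet B = ⋂ A ∈ B, Subtype.val ⁻¹' {p : Ultrafilter X | A ∈ p}ᶜ := by
    ext p
    simp [hatSet]
  rw [this]
  exact isClosed_biInter fun A _ =>
    (ultrafilter_isOpen_basic A).isClosed_compl.preimage continuous_subtype_val

/-- For a downward closed family, the basic open set of `A` lies in the hat exactly when no
infinite subset of `A` is in the family. -/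
theorem setOf_mem_subset_hatSet_iff {X : Type*} {B : Set (Set X)}
    (hB : ∀ A ∈ B, ∀ A' ⊆ A, A' ∈ B) {A : Set X} :
    {p : {p : Ultrafilter X // ∀ x : X, p ≠ pure x} | A ∈ p.1} ⊆ hatSet B ↔ A ∈ negOp B := by
  constructor
  · intro h Z hZA hZ hZB
    obtain ⟨p, hp⟩ := hZ.exists_free_ultrafilter_mem
    exact h (Filter.mem_of_superset hp hZA : A ∈ p.1) Z hZB hp
  · intro h p hp C hC hCp
    exact h (A ∩ C) inter_subset_left
      (Ultrafilter.infinite_of_mem_of_forall_ne_pure p.2 (Filter.inter_mem hp hCp))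
      (hB C hC _ inter_subset_right)

theorem hatSet_negOp {X : Type*} {B : Set (Set X)} (hB : ∀ A ∈ B, ∀ A' ⊆ A, A' ∈ B) :
    hatSet (negOp B) = (interior (hatSet B))ᶜ := by
  ext p
  rw [mem_compl_iff, mem_interior_iff_mem_nhds,
    (ultrafilterBasis_is_basis.induced Subtype.val).mem_nhds_iff]
  constructor
  · rintro hp ⟨_, ⟨_, ⟨A, rfl⟩, rfl⟩, hAp, hA⟩
    exact hp A ((setOf_mem_subset_hatSet_iff hB).1 hA) hAp
  · intro hp A hA hAp
    exact hp ⟨_, ⟨_, ⟨A, rfl⟩, rfl⟩, hAp, (setOf_mem_subset_hatSet_iff hB).2 hA⟩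

theorem stmt_12 {X : Type*} [Infinite X] (B : Set (Set X)) (hB : IsBornology B) :
    hatSet (negOp B) = closure ((closure (interior (hatSet B)))ᶜ) := by
  rw [hatSet_negOp hB.1, closure_compl]
  exact congrArg compl <| Subset.antisymm (isOpen_interior.subset_interior_iff.2 subset_closure)
    (interior_mono (closure_minimal interior_subset (isClosed_hatSet B)))
end
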